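/- Let $T$ be a skew semistandard tableau of shape $\lambda - \rho$ with $N$ boxes. Write $w(T) = a_N \cdots a_1$ and set $b_i = R(a_i \to [a_{i-1}\cdots a_1 \to \emptyset])$, the row index of the new box when $a_i$ is column-inserted. Then the word $\sigma(T) = b_N \cdots b_1$ is compatible with the shape $\lambda - \rho$, i.e., it is the reading word of some semistandard tableau of shape $\lambda - \rho$. -/

import Mathlib

namespace DK

/-- `l` is a partition: weakly decreasing list of positive parts. -/
def IsPartition (l : List ℕ) : Prop :=
  List.Chain' (fun a b => b ≤ a) l ∧ ∀ x ∈ l, 0 < x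

/- ## Column insertion, tableaux as lists of columns -/

/-- Insert a letter into a single (strictly increasing) column, returning the
bumped letter (if any) and the new column. -/
def insertCol (a : ℕ) : List ℕ → Option ℕ × List ℕ
  | [] => (none, [a])
  | x :: xs =>
      if a ≤ x then (some x, a :: xs)
      else
        let r := insertCol a xs
        (r.1, x :: r.2)

/-- Column insertion `[a → T]` for a tableau `T` given as its list of columns. -/
def colInsert (a : ℕ) : List (List ℕ) → List (List ℕ)
  | [] => [[a]]
  | c :: cs =>
      match insertCol a c with
      | (none, c') => c' :: cs
      | (some b, c') => c' :: colInsert b cs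

/-- `R(a → T)`: the (1-indexed) row in which the new box appears in `[a → T]`. -/
def newRow (a : ℕ) : List (List ℕ) → ℕ
  | [] => 1
  | c :: cs =>
      match insertCol a c with
      | (none, _) => c.length + 1
      | (some b, _) => newRow b cs

/-- Insert the letters of a word into `T`, the head of the list first (our word
lists are in reading order: the head is the first letter read, which is the
first letter inserted in `[w → T]`). -/
def insertList : List ℕ → List (List ℕ) → List (List ℕ)
  | [], T => T
  | a :: rest, T => insertList rest (colInsert a T)

def sigmaWordAux : List (List ℕ) → List ℕ → List ℕ
  | _, [] => []
  | T, a :: rest => newRow a T :: sigmaWordAux (colInsert a T) rest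

/-- The word `σ(T) = b_N ⋯ b_1` of row indices of the new boxes in the column
insertion of the word `w` into the empty tableau, in the same positional
encoding as `w` itself. -/
def sigmaWord (w : List ℕ) : List ℕ := sigmaWordAux [] w

/-- Iterated insertion of `a 1, a 2, …, a k` into `T`. -/
def insertUpTo (a : ℕ → ℕ) (T : List (List ℕ)) : ℕ → List (List ℕ)
  | 0 => T
  | k+1 => colInsert (a (k+1)) (insertUpTo a T k)

/-- `T` (a list of columns) is a semistandard tableau of partition shape with
positive entries: columns strictly increasing, column lengths weakly
decreasing, rows weakly increasing. -/
structure IsColTab (T : List (List ℕ)) : Prop where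
  ne : ∀ c ∈ T, c ≠ ([] : List ℕ)
  pos : ∀ c ∈ T, ∀ x ∈ c, 0 < x
  colStrict : ∀ c ∈ T, List.Chain' (· < ·) c
  lenDecr : List.Chain' (fun a b => b ≤ a) (T.map List.length)
  rowWeak : ∀ j i, i < (T.getD (j+1) []).length →
      (T.getD j []).getD i 0 ≤ (T.getD (j+1) []).getD i 0

/- ## Charge (Lascoux–Schützenberger) -/

/-- Reading leftwards (cyclically) from position `start` in `w`, the position
of the first occurrence of the letter `t`. -/
def chooseNext (w : List ℕ) (start t : ℕ) : Option ℕ :=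
  let occ := (List.range w.length).filter (fun p => w.getD p 0 = t)
  ((occ.filter (fun p => p < start)).max?) <|> ((occ.filter (fun p => start < p)).max?)

def extractAux (w : List ℕ) : ℕ → ℕ → ℕ → List ℕ
  | 0, _, _ => []
  | fuel+1, start, t =>
      match chooseNext w start t with
      | none => []
      | some p => p :: extractAux w fuel p (t+1)

/-- Positions of the first extracted standard subword of `w`. -/
def extract (w : List ℕ) : List ℕ :=
  extractAux w w.length w.length 1

def chargeIdxAux : ℕ → ℕ → List ℕ → ℕ
  | _, _, [] => 0
  | idx, prev, p :: ps =>
      let idx' := if p < prev then idx + 1 else idx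
      idx' + chargeIdxAux idx' p ps

/-- Charge of a standard subword given by the positions of its letters
`1, 2, …`: the letter `1` has index `0`, and the letter `r+1` has the index of
`r`, increased by one exactly when `r+1` lies to the left of `r`. -/
def chargePos : List ℕ → ℕ
  | [] => 0
  | p :: ps => chargeIdxAux 0 p ps

def removePositions (w : List ℕ) (ps : List ℕ) : List ℕ :=
  ((List.range w.length).filter (fun p => p ∉ ps)).map (fun p => w.getD p 0)

def chargeFuel : ℕ → List ℕ → ℕ
  | 0, _ => 0
  | fuel+1, w =>
      if w.isEmpty then 0
      else
        let ps := extract w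
        chargePos ps + chargeFuel fuel (removePositions w ps)

/-- The charge of a word of partition weight, obtained by repeatedly extracting
standard subwords and summing their charges. -/
def charge (w : List ℕ) : ℕ := chargeFuel w.length w

/-- The word `w` has positive letters and partition weight. -/
def HasPartitionWeight (w : List ℕ) : Prop :=
  (∀ x ∈ w, 0 < x) ∧ ∀ i, 1 ≤ i → w.count (i+1) ≤ w.count i

/- ## Knuth equivalence -/

/-- Elementary Knuth transformations. -/
inductive KnuthStep : List ℕ → List ℕ → Prop
  | k1 (u v : List ℕ) (x y z : ℕ) (hxy : x ≤ y) (hyz : y < z) :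
      KnuthStep (u ++ x :: z :: y :: v) (u ++ z :: x :: y :: v)
  | k2 (u v : List ℕ) (x y z : ℕ) (hxy : x < y) (hyz : y ≤ z) :
      KnuthStep (u ++ y :: z :: x :: v) (u ++ y :: x :: z :: v)

/-- Knuth equivalence: the equivalence relation generated by the elementary
Knuth transformations. -/
def KnuthEquiv : List ℕ → List ℕ → Prop := Relation.EqvGen KnuthStep

/- ## Skew tableaux as functions `ℕ → ℕ → ℕ` (`0` = empty box) -/

/-- `f` is a semistandard skew tableau of shape `lam - rho` (row `i` occupies
columns `rho_i ≤ j < lam_i`, everything 0-indexed): the support is exactly the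
skew shape, rows weakly increase and columns strictly increase. -/
def IsSkewFn (lam rho : List ℕ) (f : ℕ → ℕ → ℕ) : Prop :=
  (∀ i j, f i j ≠ 0 ↔ (rho.getD i 0 ≤ j ∧ j < lam.getD i 0)) ∧
  (∀ i j j', rho.getD i 0 ≤ j → j ≤ j' → j' < lam.getD i 0 → f i j ≤ f i j') ∧
  (∀ i j, f i j ≠ 0 → f (i+1) j ≠ 0 → f i j < f (i+1) j)

/-- The (row-)reading word of `f`, within the bounding box `R × C`: letters are
read right to left in successive rows, starting with the top row; the head of
the list is the first letter read. -/
def readWordF (R C : ℕ) (f : ℕ → ℕ → ℕ) : List ℕ :=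
  ((List.range R).map (fun i =>
    ((List.range C).reverse.map (f i)).filter (fun x => x ≠ 0))).flatten

/-- The word `w` has weight `mu`: the letter `i+1` occurs `mu_i` times. -/
def wtEq (w : List ℕ) (mu : List ℕ) : Prop := ∀ i, w.count (i+1) = mu.getD i 0

/-- `w` is a lattice permutation: in each final segment of the reading
(i.e. each suffix of the list), `i` occurs at least as often as `i+1`. -/
def IsLattice (w : List ℕ) : Prop :=
  ∀ k i, 1 ≤ i → (w.drop k).count (i+1) ≤ (w.drop k).count i

/- ## Jeu de taquin -/

/-- Update a two-variable function at one point. -/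
def upd (f : ℕ → ℕ → ℕ) (i j v : ℕ) : ℕ → ℕ → ℕ :=
  fun i' j' => if i' = i ∧ j' = j then v else f i' j'

/-- One upper jeu de taquin slide: the pawn starts at `(i, j)` and repeatedly
exchanges with the smaller of the letters to its right and below it (the one
below in case of ties), until neither exists.  Returns the resulting tableau
together with the final position of the hole. -/
def slideU : ℕ → (ℕ → ℕ → ℕ) → ℕ → ℕ → ((ℕ → ℕ → ℕ) × ℕ × ℕ)
  | 0, f, i, j => (f, i, j)
  | fuel+1, f, i, j =>
      let r := f i (j+1)
      let b := f (i+1) j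
      if b = 0 ∧ r = 0 then (f, i, j)
      else if b ≠ 0 ∧ (r = 0 ∨ b ≤ r) then
        slideU fuel (upd (upd f i j b) (i+1) j 0) (i+1) j
      else
        slideU fuel (upd (upd f i j r) i (j+1) 0) i (j+1)

/-- One lower jeu de taquin slide: the pawn starts at `(i, j)` and repeatedly
exchanges with the larger of the letters to its left and above it (the one
above in case of ties), until neither exists. -/
def slideL : ℕ → (ℕ → ℕ → ℕ) → ℕ → ℕ → (ℕ → ℕ → ℕ)
  | 0, f, _, _ => f
  | fuel+1, f, i, j =>
      let l := if j = 0 then 0 else f i (j-1)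
      let u := if i = 0 then 0 else f (i-1) j
      if l = 0 ∧ u = 0 then f
      else if u ≠ 0 ∧ (l = 0 ∨ l ≤ u) then
        slideL fuel (upd (upd f i j u) (i-1) j 0) (i-1) j
      else
        slideL fuel (upd (upd f i j l) i (j-1) 0) i (j-1)

/-- Rectification of a skew tableau of shape `lam - rho`: repeatedly slide into
the inner corner at the end of the lowest row with nonzero inner shape,
updating the shape along the way, until the inner shape is empty. -/
def rectify (B : ℕ) : ℕ → List ℕ → List ℕ → (ℕ → ℕ → ℕ) → (ℕ → ℕ → ℕ)
  | 0, _, _, f => f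
  | fuel+1, lam, rho, f =>
      match ((List.range lam.length).filter (fun i => 0 < rho.getD i 0)).max? with
      | none => f
      | some i =>
          let s := slideU B f i (rho.getD i 0 - 1)
          rectify B fuel (lam.set s.2.1 s.2.2) (rho.set i (rho.getD i 0 - 1)) s.1

/-- The jeu de taquin rectification `jdt(T)` of a skew tableau of shape
`lam - rho`. -/
def rect (lam rho : List ℕ) (f : ℕ → ℕ → ℕ) : ℕ → ℕ → ℕ :=
  rectify (lam.length + lam.headD 0 + 1) (rho.sum + 1) lam rho f

/-- The tableau function associated to a list of columns. -/
def colsToFn (cols : List (List ℕ)) : ℕ → ℕ → ℕ :=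
  fun i j => (cols.getD j []).getD i 0


/- ## Polynomial / fermionic machinery -/

/-- The Gaussian binomial coefficient `[p+m choose m]_t` as a polynomial,
defined by the `q`-Pascal recurrence. -/
noncomputable def gauss : ℕ → ℕ → Polynomial ℤ
  | _, 0 => 1
  | 0, _ + 1 => 1
  | p + 1, m + 1 => gauss p (m + 1) + Polynomial.X ^ (p + 1) * gauss (p + 1) m
  termination_by p m => p + m

/-- `n(μ) = Σ_i (i-1) μ_i`. -/
def nstat (mu : List ℕ) : ℕ := ∑ i ∈ Finset.range mu.length, i * mu.getD i 0

/-- `Q_i(λ) = Σ_j min(i, λ_j)`. -/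
def Qi (i : ℕ) (l : List ℕ) : ℤ := ((l.map (fun x => min i x)).sum : ℤ)

/-- `Σ_{i,j} min(i,j) m_i(λ) m_j(κ)`, computed as `Σ_{x ∈ λ, y ∈ κ} min(x,y)`. -/
def pairMin (l k : List ℕ) : ℤ :=
  ((l.map (fun x => (k.map (fun y => min x y)).sum)).sum : ℤ)

/-- Vacancy numbers `p_i^{(a)}` of a configuration `nu` (where `nu 0 = μ` is
the multiplicity data and `nu a = []` for `a ≥ n`). -/
def pVac (nu : ℕ → List ℕ) (a i : ℕ) : ℤ :=
  Qi i (nu (a-1)) - 2 * Qi i (nu a) + Qi i (nu (a+1))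

/-- Admissible `L(μ)`-configurations of weight `lam` in type `A_{n-1}`. -/
def AdmConf (n : ℕ) (mu lam : List ℕ) : Set (ℕ → List ℕ) :=
  {nu | (∀ a, IsPartition (nu a)) ∧ nu 0 = mu ∧ (∀ a, n ≤ a → nu a = []) ∧
    (∀ a, 1 ≤ a → a ≤ n - 1 → (nu a).sum = (lam.drop a).sum) ∧
    (∀ a i, 1 ≤ a → a ≤ n - 1 → 1 ≤ i → 0 ≤ pVac nu a i)}

/-- The cocharge `cc(ν) = ½ Σ_{a,b∈I₀} (α_a,α_b) Σ_{i,j} min(i,j) m_i^{(a)} m_j^{(b)}`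
of a configuration, written without the factor `½` by collecting the diagonal
terms (`(α_a,α_a) = 2`) and the adjacent terms (`(α_a,α_{a±1}) = -1`). -/
def ccConf (n : ℕ) (nu : ℕ → List ℕ) : ℤ :=
  (∑ a ∈ Finset.Icc 1 (n-1), pairMin (nu a) (nu a)) -
  (∑ a ∈ Finset.Icc 1 (n-2), pairMin (nu a) (nu (a+1)))

/-- The set of semistandard tableaux of straight shape `lam` and weight `mu`,
as functions. -/
def TabSet (lam mu : List ℕ) : Set (ℕ → ℕ → ℕ) :=
  {f | IsSkewFn lam [] f ∧ wtEq (readWordF lam.length (lam.headD 0) f) mu}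

/-- The Kostka polynomial `K_{λ,μ}(t)`, via the Lascoux–Schützenberger charge
formula `K_{λ,μ}(t) = Σ_{T ∈ Tab(λ,μ)} t^{c(T)}`. -/
noncomputable def kostka (lam mu : List ℕ) : Polynomial ℤ :=
  ∑ᶠ f ∈ TabSet lam mu,
    (Polynomial.X : Polynomial ℤ) ^ charge (readWordF lam.length (lam.headD 0) f)

/-- The Littlewood–Richardson coefficient `c^ν_{λ',λ''}`: the number of
semistandard skew tableaux of shape `ν - λ'` and weight `λ''` whose reading
word is a lattice permutation. -/
noncomputable def lrCoeff (l' l'' nu : List ℕ) : ℕ :=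
  {f : ℕ → ℕ → ℕ | IsSkewFn nu l' f ∧
    IsLattice (readWordF nu.length (nu.headD 0) f) ∧
    wtEq (readWordF nu.length (nu.headD 0) f) l''}.ncard

/-- The fermionic formula `M(μ, λ; t)` of type `A_{n-1}`, as a Laurent
polynomial: the sum over admissible configurations of
`t^{cc(ν)} Π_{(a,i)} [p_i^{(a)} + m_i^{(a)}, m_i^{(a)}]_t`. -/
noncomputable def fermionicM (n : ℕ) (mu lam : List ℕ) : LaurentPolynomial ℤ :=
  ∑ᶠ nu ∈ AdmConf n mu lam,
    LaurentPolynomial.T (ccConf n nu) *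
      ∏ᶠ a ∈ Set.Icc 1 (n-1), ∏ᶠ i ∈ {i : ℕ | 1 ≤ i},
        Polynomial.toLaurent (gauss ((pVac nu a i).toNat) ((nu a).count i))

/- ## Rigged configurations (with riggings as multisets of strings) -/

/-- `Q_i` for a multiset of parts. -/
def QiM (i : ℕ) (s : Multiset ℕ) : ℤ := ((s.map (fun x => min i x)).sum : ℤ)

/-- The underlying configuration of a rigged configuration: `ν^{(0)} = μ`, and
`ν^{(a)}` is the multiset of string lengths of `RC a` for `a ≥ 1`. -/
def nuOf (mu : List ℕ) (RC : ℕ → Multiset (ℕ × ℤ)) (a : ℕ) : Multiset ℕ :=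
  if a = 0 then (mu : Multiset ℕ) else (RC a).map Prod.fst

/-- Vacancy numbers of a rigged configuration. -/
def pRC (mu : List ℕ) (RC : ℕ → Multiset (ℕ × ℤ)) (a i : ℕ) : ℤ :=
  QiM i (nuOf mu RC (a-1)) - 2 * QiM i (nuOf mu RC a) + QiM i (nuOf mu RC (a+1))

/-- Basic validity of a rigged configuration in type `A_{n-1}`: nothing outside
`1 ≤ a ≤ n-1`, and all string lengths are positive. -/
def RCvalid (n : ℕ) (RC : ℕ → Multiset (ℕ × ℤ)) : Prop :=
  RC 0 = 0 ∧ (∀ a, n ≤ a → RC a = 0) ∧ ∀ a s, s ∈ RC a → 1 ≤ s.1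

end DK

namespace DK

/- ## Insertion into one column -/

/-- Inserting `a` into `r` overwrites the position `p` of the first entry `≥ a`, where `p` is
the end of the column if there is no such entry. -/
theorem insertCol_spec (a : ℕ) (r : List ℕ) :
    ∃ p : ℕ, (∀ i < p, ∃ y, r[i]? = some y ∧ y < a) ∧ (∀ y, r[p]? = some y → a ≤ y) ∧
      (insertCol a r).1 = r[p]? ∧
      ∀ i, (insertCol a r).2[i]? = if i = p then some a else r[i]? := by
  induction r with
  | nil =>
    refine ⟨0, by simp, by simp, by simp [insertCol], fun i => ?_⟩
    cases i <;> simp [insertCol]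
  | cons x xs ih =>
    by_cases h : a ≤ x
    · refine ⟨0, by simp, by simpa using h, by simp [insertCol, h], fun i => ?_⟩
      cases i <;> simp [insertCol, h]
    · obtain ⟨p, h1, h2, h3, h4⟩ := ih
      refine ⟨p + 1, fun i hi => ?_, by simpa using h2, by simpa [insertCol, h] using h3,
        fun i => ?_⟩
      · cases i with
        | zero => exact ⟨x, by simp, by omega⟩
        | succ i => simpa using h1 i (by omega)
      · cases i with
        | zero => simp [insertCol, h]
        | succ i => simpa [insertCol, h] using h4 i

theorem length_insertCol (a : ℕ) (r : List ℕ) :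
    (insertCol a r).2.length = r.length + if (insertCol a r).1 = none then 1 else 0 := by
  induction r with
  | nil => simp [insertCol]
  | cons x xs ih =>
    by_cases h : a ≤ x
    · simp [insertCol, h]
    · simp only [insertCol, h, if_false, List.length_cons, ih]
      omega

/-- The entries of the column `r` strictly increase. -/
def StrictCol (r : List ℕ) : Prop :=
  ∀ i j x y : ℕ, i < j → r[i]? = some x → r[j]? = some y → x < y

theorem StrictCol.insertCol {r : List ℕ} (hc : StrictCol r) (a : ℕ) :
    StrictCol (insertCol a r).2 := by
  obtain ⟨p, h1, h2, -, h4⟩ := insertCol_spec a r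
  intro i j x y hij hx hy
  rw [h4] at hx hy
  split_ifs at hx hy with hi hj hj
  · omega
  · obtain rfl : a = x := by simpa using hx
    rcases hcp : r[p]? with _ | z
    · rw [List.getElem?_eq_none_iff] at hcp
      have := (List.getElem?_eq_some_iff.1 hy).1
      omega
    · have := hc p j z y (by omega) hcp hy
      have := h2 z hcp
      omega
  · obtain rfl : a = y := by simpa using hy
    obtain ⟨z, hz, hza⟩ := h1 i (by omega)
    simp_all
  · exact hc i j x y hij hx hy

theorem mem_insertCol_self (a : ℕ) (r : List ℕ) : a ∈ (insertCol a r).2 := by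
  obtain ⟨p, -, -, -, h4⟩ := insertCol_spec a r
  exact List.mem_iff_getElem?.2 ⟨p, by simp [h4]⟩

theorem eq_or_mem_of_mem_insertCol {a y : ℕ} {r : List ℕ} (h : y ∈ (insertCol a r).2) :
    y = a ∨ y ∈ r := by
  obtain ⟨p, -, -, -, h4⟩ := insertCol_spec a r
  obtain ⟨i, hi⟩ := List.mem_iff_getElem?.1 h
  rw [h4] at hi
  split_ifs at hi with hip
  · left; simpa using hi.symm
  · exact Or.inr (List.mem_iff_getElem?.2 ⟨i, hi⟩)

theorem insertCol_bump {a b : ℕ} {r : List ℕ} (hc : StrictCol r)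
    (h : (insertCol a r).1 = some b) : b ∈ r ∧ a ≤ b ∧ ∀ y ∈ r, a ≤ y → b ≤ y := by
  obtain ⟨p, h1, h2, h3, -⟩ := insertCol_spec a r
  rw [h3] at h
  refine ⟨List.mem_iff_getElem?.2 ⟨p, h⟩, h2 b h, fun y hy hay => ?_⟩
  obtain ⟨i, hi⟩ := List.mem_iff_getElem?.1 hy
  rcases lt_trichotomy i p with hip | rfl | hip
  · obtain ⟨z, hz, hza⟩ := h1 i hip
    simp_all
    omega
  · simp_all
  · exact (hc p i b y hip h hi).le

theorem lt_of_insertCol_eq_none {a y : ℕ} {r : List ℕ}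
    (h : (insertCol a r).1 = none) (hy : y ∈ r) : y < a := by
  obtain ⟨p, h1, -, h3, -⟩ := insertCol_spec a r
  rw [h3, List.getElem?_eq_none_iff] at h
  obtain ⟨i, hi⟩ := List.mem_iff_getElem?.1 hy
  obtain ⟨z, hz, hza⟩ := h1 i ((List.getElem?_eq_some_iff.1 hi).1.trans_le h)
  simp_all

theorem bump_lt_of_mem_insertCol {a b y : ℕ} {r : List ℕ} (hc : StrictCol r)
    (h : (insertCol a r).1 = some b) (hy : y ∈ (insertCol a r).2) (hay : a < y) : b < y := by
  obtain ⟨p, h1, -, h3, h4⟩ := insertCol_spec a r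
  rw [h3] at h
  obtain ⟨i, hi⟩ := List.mem_iff_getElem?.1 hy
  rw [h4] at hi
  split_ifs at hi with hip
  · obtain rfl : a = y := by simpa using hi
    omega
  · rcases lt_or_gt_of_ne hip with hip | hip
    · obtain ⟨z, hz, hza⟩ := h1 i hip
      simp_all
      omega
    · exact hc p i b y hip h hi

/-- The columns `r`, `d` can be neighbours in a tableau: `d` is no longer than `r`, and is
entrywise at least `r`. -/
def ColLE (r d : List ℕ) : Prop := ∀ i y : ℕ, d[i]? = some y → ∃ x, r[i]? = some x ∧ x ≤ y

theorem ColLE.length_le {r d : List ℕ} (h : ColLE r d) : d.length ≤ r.length := by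
  by_contra! hlt
  obtain ⟨x, hx, -⟩ := h r.length _ (List.getElem?_eq_getElem hlt)
  simp at hx

theorem ColLE.insertCol_none {r d : List ℕ} (h : ColLE r d) {a : ℕ}
    (ha : (insertCol a r).1 = none) : ColLE (insertCol a r).2 d := by
  obtain ⟨p, -, -, h3, h4⟩ := insertCol_spec a r
  intro i y hy
  obtain ⟨x, hx, hxy⟩ := h i y hy
  refine ⟨x, ?_, hxy⟩
  rw [h4, if_neg, hx]
  rintro rfl
  simp_all

theorem ColLE.insertCol_some {r d : List ℕ} (h : ColLE r d) {a b : ℕ}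
    (ha : (insertCol a r).1 = some b) : ColLE (insertCol a r).2 (insertCol b d).2 := by
  obtain ⟨p, h1, h2, h3, h4⟩ := insertCol_spec a r
  obtain ⟨q, k1, -, -, k4⟩ := insertCol_spec b d
  rw [h3] at ha
  have hab := h2 b ha
  have hqp : q ≤ p := by
    by_contra! hlt
    obtain ⟨y, hy, hyb⟩ := k1 p hlt
    obtain ⟨x, hx, hxy⟩ := h p y hy
    simp_all
    omega
  intro i y hy
  rw [k4] at hy
  rw [h4]
  split_ifs at hy ⊢ with h₁ h₂ h₃
  · exact ⟨a, rfl, by simp_all⟩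
  · obtain ⟨x, hx, hxy⟩ := h i y hy
    refine ⟨a, rfl, ?_⟩
    simp_all
    omega
  · obtain ⟨z, hz, hza⟩ := h1 i (by omega)
    exact ⟨z, hz, by simp only [Option.some.injEq] at hy; omega⟩
  · exact h i y hy

/- ## Streams of letters passing through a column

`A t` is the letter, if any, that reaches a column at time `t`. -/

/-- The column at time `t`, initially empty. -/
def colAt (A : ℕ → Option ℕ) : ℕ → List ℕ
  | 0 => []
  | t + 1 =>
      match A t with
      | none => colAt A t
      | some a => (insertCol a (colAt A t)).2

/-- The stream of letters bumped out of the column. -/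
def bumped (A : ℕ → Option ℕ) (t : ℕ) : Option ℕ :=
  (A t).bind fun a => (insertCol a (colAt A t)).1

/-- The stream of letters that reach the `k`-th column. -/
def stream (A : ℕ → Option ℕ) : ℕ → ℕ → Option ℕ
  | 0 => A
  | k + 1 => bumped (stream A k)

variable {A : ℕ → Option ℕ}

theorem colAt_succ_none {t : ℕ} (h : A t = none) : colAt A (t + 1) = colAt A t := by
  simp [colAt, h]

theorem colAt_succ_some {t a : ℕ} (h : A t = some a) :
    colAt A (t + 1) = (insertCol a (colAt A t)).2 := by
  simp [colAt, h]

theorem bumped_of_none {t : ℕ} (h : A t = none) : bumped A t = none := by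
  simp [bumped, h]

theorem bumped_of_some {t a : ℕ} (h : A t = some a) :
    bumped A t = (insertCol a (colAt A t)).1 := by
  simp [bumped, h]

theorem exists_of_bumped {t b : ℕ} (h : bumped A t = some b) : ∃ a, A t = some a := by
  rcases hA : A t with _ | a
  · simp [bumped_of_none hA] at h
  · exact ⟨a, rfl⟩

theorem strictCol_colAt (A : ℕ → Option ℕ) (t : ℕ) : StrictCol (colAt A t) := by
  induction t with
  | zero => intro i j x y _ hx; simp [colAt] at hx
  | succ t ih =>
    rcases hA : A t with _ | a
    · rwa [colAt_succ_none hA]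
    · rw [colAt_succ_some hA]
      exact ih.insertCol a

theorem colLE_colAt (A : ℕ → Option ℕ) (t : ℕ) : ColLE (colAt A t) (colAt (bumped A) t) := by
  induction t with
  | zero => intro i y hy; simp [colAt] at hy
  | succ t ih =>
    rcases hA : A t with _ | a
    · rwa [colAt_succ_none hA, colAt_succ_none (bumped_of_none hA)]
    · rw [colAt_succ_some hA]
      rcases hb : (insertCol a (colAt A t)).1 with _ | b
      · rw [colAt_succ_none (by rw [bumped_of_some hA, hb])]
        exact ih.insertCol_none hb
      · rw [colAt_succ_some (by rw [bumped_of_some hA, hb])]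
        exact ih.insertCol_some hb

theorem length_colAt_antitone (A : ℕ → Option ℕ) (t : ℕ) :
    Antitone fun k => (colAt (stream A k) t).length :=
  antitone_nat_of_succ_le fun k => (colLE_colAt (stream A k) t).length_le

theorem length_colAt_monotone (A : ℕ → Option ℕ) : Monotone fun t => (colAt A t).length := by
  refine monotone_nat_of_le_succ fun t => ?_
  rcases hA : A t with _ | a
  · rw [colAt_succ_none hA]
  · rw [colAt_succ_some hA, length_insertCol]
    omega

theorem length_colAt_succ_of_bumped {t b : ℕ} (hb : bumped A t = some b) :
    (colAt A (t + 1)).length = (colAt A t).length := by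
  obtain ⟨a, ha⟩ := exists_of_bumped hb
  rw [bumped_of_some ha] at hb
  simp [colAt_succ_some ha, length_insertCol, hb]

/-- An entry in `[y, x]` persists as long as only letters in `[y, x]` are inserted. -/
theorem exists_mem_colAt {x y s t : ℕ} (hs : A s = some x) (hyx : y ≤ x) (hst : s < t)
    (h : ∀ u v, s < u → u < t → A u = some v → y ≤ v ∧ v ≤ x) :
    ∃ z ∈ colAt A t, y ≤ z ∧ z ≤ x := by
  induction t, hst using Nat.le_induction with
  | base => exact ⟨x, by rw [colAt_succ_some hs]; exact mem_insertCol_self _ _, hyx, le_rfl⟩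
  | succ t hst ih =>
    rcases hA : A t with _ | a
    · rw [colAt_succ_none hA]
      exact ih fun u v h1 h2 => h u v h1 (by omega)
    · rw [colAt_succ_some hA]
      exact ⟨a, mem_insertCol_self _ _, h t a (by omega) (by omega) hA⟩

/-- Entries are either old or inserted in between. -/
theorem mem_colAt_or {y s t : ℕ} (hst : s ≤ t) (hy : y ∈ colAt A t) :
    y ∈ colAt A s ∨ ∃ u, s ≤ u ∧ u < t ∧ A u = some y := by
  induction t, hst using Nat.le_induction with
  | base => exact Or.inl hy
  | succ t hst ih =>
    have key : y ∈ colAt A t → y ∈ colAt A s ∨ ∃ u, s ≤ u ∧ u < t + 1 ∧ A u = some y := by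
      intro h
      rcases ih h with h | ⟨u, h1, h2, h3⟩
      · exact Or.inl h
      · exact Or.inr ⟨u, h1, by omega, h3⟩
    rcases hA : A t with _ | a
    · exact key (by rwa [colAt_succ_none hA] at hy)
    · rw [colAt_succ_some hA] at hy
      rcases eq_or_mem_of_mem_insertCol hy with rfl | h
      · exact Or.inr ⟨t, hst, by omega, hA⟩
      · exact key h

/- ## Streams of skew tableaux -/

/-- The stream `A`, cut into rows of `C` consecutive times, is a semistandard filling: letters
weakly decrease in time along each row; and if `s ≥ p` lies in the row of `p` and letters
arrive at time `s` and, one row below `p`, at time `p + C`, then a smaller letter than the latter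
arrives at time `p`. -/
structure IsSkewStream (C : ℕ) (A : ℕ → Option ℕ) : Prop where
  row : ∀ s t x y, s ≤ t → s / C = t / C → A s = some x → A t = some y → y ≤ x
  col : ∀ p s z y, p ≤ s → p / C = s / C → A s = some z → A (p + C) = some y →
    ∃ x, A p = some x ∧ x < y

variable {C : ℕ}

theorem div_eq_of_between {s u t : ℕ} (hsu : s ≤ u) (hut : u ≤ t) (h : s / C = t / C) :
    s / C = u / C ∧ u / C = t / C := by
  have h1 := Nat.div_le_div_right (c := C) hsu
  have h2 := Nat.div_le_div_right (c := C) hut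
  omega

/-- A letter that follows another one in its row is bumped, and the bumped letter does not exceed
the earlier one. -/
theorem IsSkewStream.bumped_le (hA : IsSkewStream C A) {s t x y : ℕ} (hst : s < t)
    (hrow : s / C = t / C) (hs : A s = some x) (ht : A t = some y) :
    ∃ b, bumped A t = some b ∧ b ≤ x := by
  obtain ⟨z, hz, hyz, hzx⟩ := exists_mem_colAt hs (hA.row s t x y hst.le hrow hs ht) hst
    fun u v h1 h2 hu =>
      have h := div_eq_of_between h1.le h2.le hrow
      ⟨hA.row u t v y h2.le h.2 hu ht, hA.row s u x v h1.le h.1 hs hu⟩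
  rw [bumped_of_some ht]
  rcases hb : (insertCol y (colAt A t)).1 with _ | b
  · have := lt_of_insertCol_eq_none hb hz
    omega
  · exact ⟨b, rfl, ((insertCol_bump (strictCol_colAt A t) hb).2.2 z hz hyz).trans hzx⟩

/-- If the letter below `p` is bumped, so is the one at `p`, and it stays smaller. -/
theorem IsSkewStream.bumped_lt (hA : IsSkewStream C A) {p x y' : ℕ} (hp : A p = some x)
    (hy' : bumped A (p + C) = some y') : ∃ x', bumped A p = some x' ∧ x' < y' := by
  obtain ⟨y, hy⟩ := exists_of_bumped hy'
  obtain ⟨x₁, hx₁, hxy⟩ := hA.col p p x y le_rfl rfl hp hy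
  obtain rfl : x = x₁ := by simpa [hp] using hx₁
  have hC : 0 < C := by
    rcases Nat.eq_zero_or_pos C with rfl | h
    · simp_all
    · exact h
  rw [bumped_of_some hy] at hy'
  obtain ⟨hmem, hyy', -⟩ := insertCol_bump (strictCol_colAt A _) hy'
  have hrow : ∀ u, p < u → u < p + C → A u = some y' →
      ∃ q, q < p ∧ q / C = p / C ∧ u = q + C := by
    intro u h1 h2 hu
    have h3 := Nat.div_le_div_right (c := C) h1.le
    by_cases h : p / C = u / C
    · have := hA.row p u x y' h1.le h hp hu
      omega
    · have h4 : u / C ≤ p / C + 1 := by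
        rw [← Nat.add_div_right p hC]
        exact Nat.div_le_div_right h2.le
      have h5 : C ≤ u := by
        by_contra! hlt
        rw [Nat.div_eq_of_lt hlt] at h3 h
        exact h (Nat.le_zero.1 h3)
      refine ⟨u - C, by omega, ?_, by omega⟩
      have h6 := Nat.add_div_right (u - C) hC
      rw [Nat.sub_add_cancel h5] at h6
      omega
  have hmem' := mem_colAt_or (s := p + 1) (by omega) hmem
  rw [colAt_succ_some hp] at hmem'
  rw [bumped_of_some hp]
  rcases hmem' with hold | ⟨u, h1, h2, hu⟩
  · rcases hb : (insertCol x (colAt A p)).1 with _ | x'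
    · rcases eq_or_mem_of_mem_insertCol hold with h | h
      · omega
      · have := lt_of_insertCol_eq_none hb h
        omega
    · exact ⟨x', rfl, bump_lt_of_mem_insertCol (strictCol_colAt A p) hb hold (by omega)⟩
  · obtain ⟨q, hqp, hqrow, rfl⟩ := hrow u h1 h2 hu
    obtain ⟨v, hv, hvy⟩ := hA.col q p x y' hqp.le hqrow hp hu
    obtain ⟨b, hb, hbv⟩ := hA.bumped_le hqp hqrow hv hp
    rw [bumped_of_some hp] at hb
    exact ⟨b, hb, by omega⟩

theorem IsSkewStream.bumped (hA : IsSkewStream C A) : IsSkewStream C (bumped A) where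
  row s t x' y' hst hrow hx' hy' := by
    obtain ⟨x, hx⟩ := exists_of_bumped hx'
    obtain ⟨y, hy⟩ := exists_of_bumped hy'
    rcases hst.eq_or_lt with rfl | hlt
    · simp_all
    · obtain ⟨b, hb, hbx⟩ := hA.bumped_le hlt hrow hx hy
      obtain rfl : b = y' := by simpa [hb] using hy'
      rw [bumped_of_some hx] at hx'
      exact hbx.trans (insertCol_bump (strictCol_colAt A s) hx').2.1
  col p s z' y' hps hrow hz' hy' := by
    obtain ⟨z, hz⟩ := exists_of_bumped hz'
    obtain ⟨y, hy⟩ := exists_of_bumped hy'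
    obtain ⟨x, hx, -⟩ := hA.col p s z y hps hrow hz hy
    exact hA.bumped_lt hx hy'

theorem IsSkewStream.stream (hA : IsSkewStream C A) (k : ℕ) : IsSkewStream C (stream A k) := by
  induction k with
  | zero => exact hA
  | succ k ih => exact ih.bumped

/-- The letter of time `t` ends in column `k`. -/
def EndsAt (A : ℕ → Option ℕ) (t k : ℕ) : Prop :=
  (∃ x, stream A k t = some x) ∧ stream A (k + 1) t = none

theorem exists_stream_of_le {t k l x : ℕ} (h : stream A k t = some x) (hl : l ≤ k) :
    ∃ y, stream A l t = some y := by
  induction k, hl using Nat.le_induction generalizing x with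
  | base => exact ⟨x, h⟩
  | succ k _ ih =>
    obtain ⟨y, hy⟩ := exists_of_bumped h
    exact ih hy

theorem EndsAt.length_succ {t k : ℕ} (h : EndsAt A t k) :
    (colAt (stream A k) (t + 1)).length = (colAt (stream A k) t).length + 1 := by
  obtain ⟨⟨x, hx⟩, hn⟩ := h
  rw [stream, bumped_of_some hx] at hn
  simp [colAt_succ_some hx, length_insertCol, hn]

theorem EndsAt.le_of_stream {t k l x : ℕ} (h : EndsAt A t k) (hx : stream A l t = some x) :
    l ≤ k := by
  by_contra! hlt
  obtain ⟨y, hy⟩ := exists_stream_of_le hx hlt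
  simp [h.2] at hy

/-- Along a row, new boxes appear weakly higher as time passes. -/
theorem IsSkewStream.endsAt_row (hA : IsSkewStream C A) {s t k l : ℕ} (hst : s < t)
    (hrow : s / C = t / C) (hs : EndsAt A s k) (ht : EndsAt A t l) :
    (colAt (DK.stream A l) t).length + 1 ≤ (colAt (DK.stream A k) s).length + 1 := by
  obtain ⟨x, hx⟩ := hs.1
  have hstream : ∀ m ≤ k + 1, ∃ y, DK.stream A m t = some y := by
    intro m
    induction m with
    | zero => exact fun _ => exists_stream_of_le ht.1.choose_spec (Nat.zero_le l)
    | succ m ih =>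
      intro hm
      obtain ⟨y, hy⟩ := ih (by omega)
      obtain ⟨z, hz⟩ := exists_stream_of_le hx (l := m) (by omega)
      obtain ⟨b, hb, -⟩ := (hA.stream m).bumped_le hst hrow hz hy
      exact ⟨b, hb⟩
  have hkl : k ≤ l := by
    obtain ⟨y, hy⟩ := hstream (k + 1) le_rfl
    have := ht.le_of_stream hy
    omega
  have hconst : ∀ u, s + 1 ≤ u → u ≤ t + 1 →
      (colAt (DK.stream A k) u).length = (colAt (DK.stream A k) (s + 1)).length := by
    intro u hu
    induction u, hu using Nat.le_induction with
    | base => exact fun _ => rfl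
    | succ u hu ih =>
      intro hut
      rw [← ih (by omega)]
      rcases hv : DK.stream A k u with _ | v
      · rw [colAt_succ_none hv]
      · have hrow' := (div_eq_of_between (s := s) (u := u) (t := t) (by omega) (by omega) hrow).1
        obtain ⟨b, hb, -⟩ := (hA.stream k).bumped_le (by omega) hrow' hx hv
        exact length_colAt_succ_of_bumped hb
  have h1 := ht.length_succ
  have h2 := hs.length_succ
  have h3 := hconst (t + 1) (by omega) le_rfl
  have h4 := length_colAt_antitone A (t + 1) hkl
  simp only at h4
  omega

/-- Down a column, new boxes appear strictly lower. -/
theorem IsSkewStream.endsAt_col (hA : IsSkewStream C A) (hC : 0 < C) {s k l : ℕ}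
    (hs : EndsAt A s k) (ht : EndsAt A (s + C) l) :
    (colAt (DK.stream A k) s).length + 1 < (colAt (DK.stream A l) (s + C)).length + 1 := by
  have hlk : l ≤ k := by
    by_contra! hlt
    obtain ⟨y, hy⟩ := ht.1
    obtain ⟨z, hz⟩ := exists_stream_of_le hy hlt
    obtain ⟨x, hx⟩ := hs.1
    obtain ⟨x', hx', -⟩ := (hA.stream k).bumped_lt hx hz
    have := hs.2
    rw [DK.stream, hx'] at this
    simp at this
  have h1 := hs.length_succ
  have h2 := length_colAt_antitone A (s + 1) hlk
  have h3 := length_colAt_monotone (DK.stream A l) (show s + 1 ≤ s + C by omega)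
  simp only at h2 h3
  omega

/- ## Comparison with insertion into a tableau -/

/-- The letter that reaches the `k`-th column when `a` is inserted into `T`. -/
def route (a : ℕ) (T : List (List ℕ)) : ℕ → Option ℕ
  | 0 => some a
  | k + 1 => (route a T k).bind fun x => (insertCol x (T.getD k [])).1

theorem route_cons_none {a : ℕ} {r : List ℕ} (h : (insertCol a r).1 = none)
    (cs : List (List ℕ)) (k : ℕ) : route a (r :: cs) (k + 1) = none := by
  induction k with
  | zero => simpa [route] using h
  | succ k ih => rw [route, ih]; rfl

theorem route_cons_some {a b : ℕ} {r : List ℕ} (h : (insertCol a r).1 = some b)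
    (cs : List (List ℕ)) (k : ℕ) : route a (r :: cs) (k + 1) = route b cs k := by
  induction k with
  | zero => simpa [route] using h
  | succ k ih => rw [route, ih]; simp [route]

theorem route_nil (a k : ℕ) : route a [] (k + 1) = none := by
  induction k with
  | zero => simp [route, insertCol]
  | succ k ih => rw [route, ih]; rfl

theorem colInsert_getD (a : ℕ) (T : List (List ℕ)) (k : ℕ) :
    (colInsert a T).getD k [] =
      match route a T k with
      | none => T.getD k []
      | some x => (insertCol x (T.getD k [])).2 := by
  induction T generalizing a k with
  | nil =>
    cases k with
    | zero => simp [colInsert, route, insertCol]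
    | succ k => simp [colInsert, route_nil]
  | cons r cs ih =>
    rcases h : insertCol a r with ⟨_ | b, r'⟩
    · cases k with
      | zero => simp [colInsert, h, route]
      | succ k => simp [colInsert, h, route_cons_none (by rw [h])]
    · cases k with
      | zero => simp [colInsert, h, route]
      | succ k =>
        simp only [colInsert, h, List.getD_cons_succ, ih]
        rw [route_cons_some (b := b) (by rw [h])]

theorem newRow_spec (a : ℕ) (T : List (List ℕ)) :
    ∃ k, (∃ x, route a T k = some x) ∧ route a T (k + 1) = none ∧
      newRow a T = (T.getD k []).length + 1 := by
  induction T generalizing a with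
  | nil => exact ⟨0, ⟨a, rfl⟩, route_nil a 0, by simp [newRow]⟩
  | cons r cs ih =>
    rcases h : insertCol a r with ⟨_ | b, r'⟩
    · exact ⟨0, ⟨a, rfl⟩, route_cons_none (by rw [h]) cs 0, by simp [newRow, h]⟩
    · obtain ⟨k, hx, hn, hr⟩ := ih b
      refine ⟨k + 1, ?_, ?_, by simp [newRow, h, hr]⟩
      · rwa [route_cons_some (b := b) (by rw [h])]
      · rwa [route_cons_some (b := b) (by rw [h])]

/-- The tableau `T` has the columns that the stream `A` has produced at time `t`. -/
def HasColsAt (A : ℕ → Option ℕ) (t : ℕ) (T : List (List ℕ)) : Prop :=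
  ∀ k, T.getD k [] = colAt (stream A k) t

theorem HasColsAt.route_eq {t a : ℕ} {T : List (List ℕ)} (h : HasColsAt A t T)
    (ha : A t = some a) (k : ℕ) : route a T k = stream A k t := by
  induction k with
  | zero => exact ha.symm
  | succ k ih => rw [route, ih, h k]; rfl

theorem HasColsAt.succ_none {t : ℕ} {T : List (List ℕ)} (h : HasColsAt A t T)
    (ha : A t = none) : HasColsAt A (t + 1) T := by
  intro k
  have hk : stream A k t = none := by
    induction k with
    | zero => exact ha
    | succ k ih => exact bumped_of_none ih
  rw [colAt_succ_none hk, h k]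

theorem HasColsAt.succ_some {t a : ℕ} {T : List (List ℕ)} (h : HasColsAt A t T)
    (ha : A t = some a) : HasColsAt A (t + 1) (colInsert a T) := by
  intro k
  rw [colInsert_getD, h.route_eq ha, h k]
  rcases hk : stream A k t with _ | x
  · rw [colAt_succ_none hk]
  · rw [colAt_succ_some hk]

/-- Recording word of a stream, one entry for each time, `0` if no letter arrives. -/
theorem sigmaWordAux_stream (A : ℕ → Option ℕ) (n : ℕ) (t : ℕ) (T : List (List ℕ))
    (hT : HasColsAt A t T) :
    ∃ G : ℕ → ℕ,
      (∀ u, t ≤ u → u < t + n → A u = none → G u = 0) ∧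
      (∀ u a, t ≤ u → u < t + n → A u = some a →
        ∃ k, EndsAt A u k ∧ G u = (colAt (stream A k) u).length + 1) ∧
      sigmaWordAux T ((List.range' t n).filterMap A) =
        ((List.range' t n).map G).filter (fun x => x ≠ 0) := by
  induction n generalizing t T with
  | zero => exact ⟨fun _ => 0, by simp, fun u a h1 h2 => by omega, by simp [sigmaWordAux]⟩
  | succ n ih =>
    have hmap : ∀ (G : ℕ → ℕ) (v : ℕ),
        (List.range' (t + 1) n).map (Function.update G t v) = (List.range' (t + 1) n).map G := by
      refine fun G v => List.map_congr_left fun u hu => Function.update_of_ne ?_ _ _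
      rw [List.mem_range'_1] at hu
      omega
    rcases ha : A t with _ | a
    · obtain ⟨G, h1, h2, h3⟩ := ih (t + 1) T (hT.succ_none ha)
      refine ⟨Function.update G t 0, fun u hu hu' hAu => ?_, fun u b hu hu' hAu => ?_, ?_⟩
      · rcases hu.eq_or_lt with rfl | hlt
        · simp
        · rw [Function.update_of_ne (by omega)]
          exact h1 u hlt (by omega) hAu
      · rcases hu.eq_or_lt with rfl | hlt
        · simp [ha] at hAu
        · rw [Function.update_of_ne (by omega)]
          exact h2 u b hlt (by omega) hAu
      · rw [List.range'_succ, List.filterMap_cons_none ha, h3, List.map_cons, hmap]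
        simp
    · obtain ⟨G, h1, h2, h3⟩ := ih (t + 1) (colInsert a T) (hT.succ_some ha)
      refine ⟨Function.update G t (newRow a T), fun u hu hu' hAu => ?_,
        fun u b hu hu' hAu => ?_, ?_⟩
      · rcases hu.eq_or_lt with rfl | hlt
        · simp [ha] at hAu
        · rw [Function.update_of_ne (by omega)]
          exact h1 u hlt (by omega) hAu
      · rcases hu.eq_or_lt with rfl | hlt
        · obtain ⟨k, hx, hn, hr⟩ := newRow_spec a T
          rw [hT.route_eq ha] at hx hn
          exact ⟨k, ⟨hx, hn⟩, by rw [Function.update_self, hr, hT k]⟩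
        · rw [Function.update_of_ne (by omega)]
          exact h2 u b hlt (by omega) hAu
      · have hpos : newRow a T ≠ 0 := by
          obtain ⟨k, -, -, hr⟩ := newRow_spec a T
          omega
        rw [List.range'_succ, List.filterMap_cons_some ha, sigmaWordAux, h3, List.map_cons, hmap]
        simp [hpos]

/- ## Reading words as streams -/

theorem readWordF_eq (R C : ℕ) (f : ℕ → ℕ → ℕ) :
    readWordF R C f =
      ((List.range (R * C)).map fun t => f (t / C) (C - 1 - t % C)).filter (fun x => x ≠ 0) := by
  induction R with
  | zero => simp [readWordF]
  | succ R ih =>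
    have hsplit : readWordF (R + 1) C f =
        readWordF R C f ++ ((List.range C).reverse.map (f R)).filter (fun x => x ≠ 0) := by
      simp [readWordF, List.range_succ]
    rw [hsplit, ih, Nat.succ_mul, List.range_add, List.map_append, List.filter_append]
    congr 2
    apply List.ext_getElem
    · simp
    · intro j h1 h2
      have hj : j < C := by simpa using h1
      have hd : (R * C + j) / C = R := by
        rw [Nat.mul_comm, Nat.mul_add_div (by omega), Nat.div_eq_of_lt hj, Nat.add_zero]
      have hm : (R * C + j) % C = j := by
        rw [Nat.mul_comm, Nat.mul_add_mod, Nat.mod_eq_of_lt hj]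
      simp [hd, hm]

theorem IsPartition.getD_succ_le {l : List ℕ} (h : IsPartition l) (i : ℕ) :
    l.getD (i + 1) 0 ≤ l.getD i 0 := by
  by_cases hi : i + 1 < l.length
  · rw [List.getD_eq_getElem _ _ hi, List.getD_eq_getElem _ _ (by omega)]
    exact List.isChain_iff_getElem.1 h.1 i hi
  · rw [List.getD_eq_default _ _ (by omega)]
    exact Nat.zero_le _

theorem IsPartition.getD_le_headD {l : List ℕ} (h : IsPartition l) (i : ℕ) :
    l.getD i 0 ≤ l.headD 0 := by
  induction i with
  | zero => cases l <;> simp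
  | succ i ih => exact (h.getD_succ_le i).trans ih

/-- The stream of the entries of `f` in reading order, in rows of length `C`. -/
def readStream (C : ℕ) (f : ℕ → ℕ → ℕ) (t : ℕ) : Option ℕ :=
  if f (t / C) (C - 1 - t % C) = 0 then none else some (f (t / C) (C - 1 - t % C))

theorem readStream_eq_some {f : ℕ → ℕ → ℕ} {t x : ℕ} :
    readStream C f t = some x ↔ x ≠ 0 ∧ f (t / C) (C - 1 - t % C) = x := by
  unfold readStream
  split_ifs with h
  · simp only [false_iff]
    omega
  · simp only [Option.some.injEq]
    omega

theorem readWordF_eq_filterMap (R C : ℕ) (f : ℕ → ℕ → ℕ) :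
    readWordF R C f = (List.range (R * C)).filterMap (readStream C f) := by
  rw [readWordF_eq]
  induction List.range (R * C) with
  | nil => rfl
  | cons t l ih =>
    by_cases h : f (t / C) (C - 1 - t % C) = 0
    · rw [List.filterMap_cons_none (by simp [readStream, h]), ← ih]
      simp [h]
    · rw [List.filterMap_cons_some (by simp only [readStream, h, if_false]; rfl), ← ih]
      simp [h]

theorem mod_le_mod_of_div_eq {s t : ℕ} (hst : s ≤ t) (hrow : s / C = t / C) :
    s % C ≤ t % C := by
  have h1 := Nat.div_add_mod s C
  have h2 := Nat.div_add_mod t C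
  rw [hrow] at h1
  omega

theorem IsSkewFn.isSkewStream {lam rho : List ℕ} {f : ℕ → ℕ → ℕ} (hlam : IsPartition lam)
    (hf : IsSkewFn lam rho f) (hC : 0 < C) : IsSkewStream C (readStream C f) where
  row s t x y hst hrow hx hy := by
    rw [readStream_eq_some] at hx hy
    obtain ⟨hx0, rfl⟩ := hx
    obtain ⟨hy0, rfl⟩ := hy
    have hmod := mod_le_mod_of_div_eq hst hrow
    rw [hrow] at hx0 ⊢
    exact hf.2.1 _ _ _ ((hf.1 _ _).1 hy0).1 (by omega) ((hf.1 _ _).1 hx0).2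
  col p s z y hps hrow hz hy := by
    rw [readStream_eq_some] at hz hy
    obtain ⟨hz0, rfl⟩ := hz
    obtain ⟨hy0, rfl⟩ := hy
    rw [Nat.add_div_right p hC, Nat.add_mod_right] at hy0 ⊢
    have hmod := mod_le_mod_of_div_eq hps hrow
    have h1 := ((hf.1 _ _).1 hz0).1
    have h2 := ((hf.1 _ _).1 hy0).2
    have h3 := hlam.getD_succ_le (p / C)
    have hp : f (p / C) (C - 1 - p % C) ≠ 0 := by
      rw [hf.1]
      rw [← hrow] at h1
      exact ⟨by omega, by omega⟩
    exact ⟨_, readStream_eq_some.2 ⟨hp, rfl⟩, hf.2.2 _ _ hp hy0⟩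

end DK

/-- Lemma 1.6.1: the recording word `σ(T) = b_N ⋯ b_1` of the row indices of
the new boxes in the column insertion of the reading word of `T` is compatible
with the skew shape `λ - ρ` of `T`, i.e. it is the reading word of a
semistandard skew tableau of shape `λ - ρ`. -/
theorem sigma_compatible (N : ℕ) (lam rho mu : List ℕ) (f : ℕ → ℕ → ℕ)
    (hlam : DK.IsPartition lam)
    (hrho : DK.IsPartition rho)
    (hsub : ∀ i, rho.getD i 0 ≤ lam.getD i 0)
    (hsize : lam.sum = rho.sum + N)
    (hmu : DK.IsPartition mu) (hmusum : mu.sum = N)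
    (hf : DK.IsSkewFn lam rho f)
    (hwt : DK.wtEq (DK.readWordF lam.length (lam.headD 0) f) mu) :
    ∃ g : ℕ → ℕ → ℕ, DK.IsSkewFn lam rho g ∧
      DK.readWordF lam.length (lam.headD 0) g =
        DK.sigmaWord (DK.readWordF lam.length (lam.headD 0) f) := by

  set R := lam.length with hR
  set C := lam.headD 0 with hCdef
  have hbox : ∀ i j, f i j ≠ 0 → i < R ∧ j < C := by
    intro i j hij
    have hj := ((hf.1 i j).1 hij).2
    refine ⟨?_, hj.trans_le (hlam.getD_le_headD i)⟩
    by_contra! hle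
    rw [List.getD_eq_default _ _ hle] at hj
    omega
  obtain ⟨G, hG0, hG1, hG⟩ := DK.sigmaWordAux_stream (DK.readStream C f) (R * C) 0 []
    fun k => by simp [DK.colAt]
  simp only [Nat.zero_le, forall_const, Nat.zero_add, ← List.range_eq_range'] at hG0 hG1 hG
  let time : ℕ → ℕ → ℕ := fun i j => C * i + (C - 1 - j)
  have hdiv : ∀ i j, j < C → time i j / C = i := fun i j hj => by
    rw [Nat.mul_add_div (by omega), Nat.div_eq_of_lt (by omega), Nat.add_zero]
  have hmod : ∀ i j, j < C → C - 1 - time i j % C = j := fun i j hj => by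
    rw [Nat.mul_add_mod, Nat.mod_eq_of_lt (by omega)]
    omega
  have hlt : ∀ i j, i < R → j < C → time i j < R * C := fun i j hi hj => by
    have : C * (i + 1) ≤ C * R := Nat.mul_le_mul_left C hi
    have hCR := Nat.mul_comm C R
    simp only [time]
    rw [Nat.mul_succ] at this
    omega
  have hread : ∀ i j, f i j ≠ 0 → DK.readStream C f (time i j) = some (f i j) := fun i j hij => by
    have hj := (hbox i j hij).2
    rw [DK.readStream_eq_some, hdiv i j hj, hmod i j hj]
    exact ⟨hij, rfl⟩
  have hends : ∀ i j, f i j ≠ 0 → ∃ k, DK.EndsAt (DK.readStream C f) (time i j) k ∧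
      G (time i j) = (DK.colAt (DK.stream (DK.readStream C f) k) (time i j)).length + 1 :=
    fun i j hij => hG1 _ _ (hlt i j (hbox i j hij).1 (hbox i j hij).2) (hread i j hij)
  let g : ℕ → ℕ → ℕ := fun i j => if f i j = 0 then 0 else G (time i j)
  have hg : ∀ i j, f i j ≠ 0 → g i j = G (time i j) := fun i j hij => if_neg hij
  have hsupp : ∀ i j, g i j ≠ 0 ↔ f i j ≠ 0 := by
    refine fun i j => ⟨fun h h0 => h (if_pos h0), fun h => ?_⟩
    obtain ⟨k, -, hk⟩ := hends i j h
    rw [hg i j h, hk]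
    omega
  refine ⟨g, ⟨fun i j => (hsupp i j).trans (hf.1 i j), fun i j j' h1 h2 h3 => ?_,
    fun i j h1 h2 => ?_⟩, ?_⟩
  · rcases h2.eq_or_lt with rfl | hjj
    · exact le_rfl
    have hij : f i j ≠ 0 := (hf.1 i j).2 ⟨h1, by omega⟩
    have hij' : f i j' ≠ 0 := (hf.1 i j').2 ⟨by omega, h3⟩
    have hj' := (hbox i j' hij').2
    obtain ⟨k, hk, hGk⟩ := hends i j' hij'
    obtain ⟨l, hl, hGl⟩ := hends i j hij
    rw [hg i j hij, hg i j' hij', hGk, hGl]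
    refine (hf.isSkewStream hlam (by omega)).endsAt_row ?_ ?_ hk hl
    · simp only [time]
      omega
    · rw [hdiv i j (by omega), hdiv i j' hj']
  · rw [hsupp] at h1 h2
    have hC : 0 < C := (Nat.zero_le j).trans_lt (hbox i j h1).2
    obtain ⟨k, hk, hGk⟩ := hends i j h1
    obtain ⟨l, hl, hGl⟩ := hends (i + 1) j h2
    have htime : time (i + 1) j = time i j + C := by
      simp only [time, Nat.mul_succ]
      omega
    rw [hg i j h1, hg (i + 1) j h2, hGk, hGl]
    rw [htime] at hl ⊢
    exact (hf.isSkewStream hlam hC).endsAt_col hC hk hl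
  · rw [DK.sigmaWord, DK.readWordF_eq_filterMap R C f, hG, DK.readWordF_eq]
    congr 1
    refine List.map_congr_left fun t ht => ?_
    rw [List.mem_range] at ht
    have hC : 0 < C := Nat.pos_of_ne_zero fun h => by simp [h] at ht
    have ht' : time (t / C) (C - 1 - t % C) = t := by
      have h1 := Nat.div_add_mod t C
      have h2 := Nat.mod_lt t hC
      simp only [time]
      omega
    by_cases h : f (t / C) (C - 1 - t % C) = 0
    · rw [hG0 t ht (by simp [DK.readStream, h])]
      exact if_pos h
    · rw [hg _ _ h, ht']
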